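/- arXiv:2005.14307 — 7 statements merged into one kernel-verified Lean document; each statement's English description precedes it below -/
import Mathlib

section
/- Let f_0, f_1, …, f_k : ℕ → ℕ be a finite collection of injective computable functions and let C ⊆ ℕ be an infinite computable set. Then there is an infinite computable set H ⊆ C such that for every i ≤ k, the upper density of the image f_i(H) is 0. -/
open Filter Set Topology

open scoped Classical

/-- The density of `A` at `n`: `|A ∩ {0,…,n−1}| / n`. -/
noncomputable def pdens (A : Set ℕ) (n : ℕ) : ℝ :=
  ((Finset.range n).filter (· ∈ A)).card / n

/-- The upper density of `A`. -/
noncomputable def upperDensity (A : Set ℕ) : ℝ :=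
  Filter.limsup (pdens A) Filter.atTop

/-- The lower density of `A`. -/
noncomputable def lowerDensity (A : Set ℕ) : ℝ :=
  Filter.liminf (pdens A) Filter.atTop

/-- `A` has (asymptotic) density `r`. -/
def HasDensity (A : Set ℕ) (r : ℝ) : Prop :=
  Filter.Tendsto (pdens A) Filter.atTop (nhds r)

/-- The `n`-th element of `A` in increasing order. -/
noncomputable def nthElem (A : Set ℕ) (n : ℕ) : ℕ :=
  Nat.nth (· ∈ A) n

/-- A computable permutation of `ℕ`. -/
def IsComputablePerm (π : ℕ → ℕ) : Prop :=
  Function.Bijective π ∧ Computable π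

/-- `A` has intrinsic density `r`: the density of `π(A)` exists and equals `r`
for every computable permutation `π`. -/
def HasIntrinsicDensity (A : Set ℕ) (r : ℝ) : Prop :=
  ∀ π : ℕ → ℕ, IsComputablePerm π → HasDensity (π '' A) r

/-- The join `A ⊕ B = {2n : n ∈ A} ∪ {2n+1 : n ∈ B}`. -/
def join (A B : Set ℕ) : Set ℕ :=
  (fun n => 2 * n) '' A ∪ (fun n => 2 * n + 1) '' B

/-- `B ▷ A`, "`B` into `A`": the set of `B`-th elements of `A`. -/
noncomputable def into (B A : Set ℕ) : Set ℕ :=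
  nthElem A '' B

/-- `B ◁ A`, "`B` within `A`": `{n : a_n ∈ B}`. -/
noncomputable def within (B A : Set ℕ) : Set ℕ :=
  {n | nthElem A n ∈ B}

theorem ComputablePred.and {α : Type*} [Primcodable α] {p q : α → Prop}
    (hp : ComputablePred p) (hq : ComputablePred q) : ComputablePred fun a => p a ∧ q a := by
  obtain ⟨f, hf, rfl⟩ := ComputablePred.computable_iff.1 hp
  obtain ⟨g, hg, rfl⟩ := ComputablePred.computable_iff.1 hq
  exact ComputablePred.computable_iff.2
    ⟨fun a => f a && g a, Primrec.and.to_comp.comp hf hg, by simp⟩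

theorem ComputablePred.comp {α β : Type*} [Primcodable α] [Primcodable β] {p : β → Prop}
    (hp : ComputablePred p) {f : α → β} (hf : Computable f) : ComputablePred fun a => p (f a) := by
  obtain ⟨g, hg, rfl⟩ := ComputablePred.computable_iff.1 hp
  exact ComputablePred.computable_iff.2 ⟨fun a => g (f a), hg.comp hf, rfl⟩

theorem Computable.natLt {α : Type*} [Primcodable α] {f g : α → ℕ}
    (hf : Computable f) (hg : Computable g) : ComputablePred fun a => f a < g a :=
  ComputablePred.comp (p := fun x : ℕ × ℕ => x.1 < x.2)
    (PrimrecPred.computablePred Primrec.nat_lt) (hf.pair hg)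

theorem Computable.natLe {α : Type*} [Primcodable α] {f g : α → ℕ}
    (hf : Computable f) (hg : Computable g) : ComputablePred fun a => f a ≤ g a :=
  ComputablePred.comp (p := fun x : ℕ × ℕ => x.1 ≤ x.2)
    (PrimrecPred.computablePred Primrec.nat_le) (hf.pair hg)

theorem Computable.natEq {α : Type*} [Primcodable α] {f g : α → ℕ}
    (hf : Computable f) (hg : Computable g) : ComputablePred fun a => f a = g a :=
  ComputablePred.comp (p := fun x : ℕ × ℕ => x.1 = x.2)
    (PrimrecPred.computablePred Primrec.eq) (hf.pair hg)

/-- The range of a strictly increasing computable function is computable. -/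
theorem StrictMono.computablePred_range {h : ℕ → ℕ} (hmono : StrictMono h) (hh : Computable h) :
    ComputablePred (· ∈ Set.range h) := by
  have hex : ∀ x, ∃ n, x ≤ h n := fun x => ⟨x, hmono.id_le x⟩
  have hfind := Computable.find (P := fun x n => x ≤ h n)
    (Computable.natLe Computable.fst (hh.comp Computable.snd)) hex
  refine (Computable.natEq (hh.comp hfind) Computable.id).of_eq fun x => ⟨fun hx => ⟨_, hx⟩, ?_⟩
  rintro ⟨n, rfl⟩
  exact le_antisymm (hmono.monotone (Nat.find_min' (hex (h n)) le_rfl)) (Nat.find_spec (hex (h n)))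

/-- Finitely many computable functions tending to infinity have a common computable lower bound
that tends to infinity and is at most the identity. -/
theorem exists_computable_le_tendsto_atTop {k : ℕ} (f : Fin k → ℕ → ℕ)
    (hcomp : ∀ i, Computable (f i)) (hf : ∀ i, Tendsto (f i) atTop atTop) :
    ∃ g : ℕ → ℕ, Computable g ∧ Tendsto g atTop atTop ∧ (∀ x, g x ≤ x) ∧
      ∀ i x, g x ≤ f i x := by
  induction k with
  | zero => exact ⟨id, Computable.id, tendsto_id, fun _ => le_rfl, fun i => i.elim0⟩
  | succ k ih =>
    obtain ⟨g, hg, hgt, hgid, hgf⟩ := ih (fun i => f i.succ) (fun i => hcomp _) (fun i => hf _)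
    refine ⟨fun x => min (f 0 x) (g x), Primrec.nat_min.to_comp.comp (hcomp 0) hg, ?_,
      fun x => (min_le_right _ _).trans (hgid x), fun i x => ?_⟩
    · refine tendsto_atTop.2 fun b => ?_
      filter_upwards [tendsto_atTop.1 (hf 0) b, tendsto_atTop.1 hgt b] with x h1 h2
      exact le_min h1 h2
    · refine Fin.cases (min_le_left _ _) (fun j => ?_) i
      exact (min_le_right _ _).trans (hgf j x)

/-- A sequence with quadratic growth has a range of upper density zero. -/
theorem upperDensity_range_eq_zero {u : ℕ → ℕ} (hu : ∀ n, n * n ≤ u (n + 1)) :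
    upperDensity (Set.range u) = 0 := by
  have hcard (m : ℕ) : ((Finset.range m).filter (· ∈ Set.range u)).card ≤ m.sqrt + 2 := by
    have hsub : (Finset.range m).filter (· ∈ Set.range u) ⊆
        (Finset.range (m.sqrt + 2)).image u := by
      intro x hx
      obtain ⟨hxm, n, rfl⟩ := Finset.mem_filter.1 hx
      rw [Finset.mem_range] at hxm
      refine Finset.mem_image_of_mem u (Finset.mem_range.2 ?_)
      cases n with
      | zero => omega
      | succ n =>
        have : n ≤ m.sqrt := Nat.le_sqrt.2 ((hu n).trans hxm.le)
        omega
    exact (Finset.card_le_card hsub).trans (Finset.card_image_le.trans (Finset.card_range _).le)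
  have hbound : ∀ᶠ m : ℕ in atTop, pdens (Set.range u) m ≤ 3 / √(m : ℝ) := by
    filter_upwards [eventually_ge_atTop 1] with m hm
    have hm' : (1 : ℝ) ≤ m := by exact_mod_cast hm
    have hs : 1 ≤ √(m : ℝ) := Real.one_le_sqrt.2 hm'
    have hc : (((Finset.range m).filter (· ∈ Set.range u)).card : ℝ) ≤ m.sqrt + 2 := by
      exact_mod_cast hcard m
    have hsq : √(m : ℝ) * √(m : ℝ) = m := Real.mul_self_sqrt (by positivity)
    have hns : (m.sqrt : ℝ) ≤ √(m : ℝ) := Real.nat_sqrt_le_real_sqrt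
    rw [pdens, div_le_div_iff₀ (by positivity) (by positivity)]
    nlinarith
  have hlim : Tendsto (fun m : ℕ => 3 / √(m : ℝ)) atTop (𝓝 0) :=
    tendsto_const_nhds.div_atTop (Real.tendsto_sqrt_atTop.comp tendsto_natCast_atTop_atTop)
  refine Tendsto.limsup_eq (tendsto_of_tendsto_of_tendsto_of_le_of_le' tendsto_const_nhds hlim
    (Eventually.of_forall fun m => ?_) hbound)
  exact div_nonneg (Nat.cast_nonneg _) (Nat.cast_nonneg _)

theorem stmt4 (k : ℕ) (f : Fin (k + 1) → ℕ → ℕ)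
    (hinj : ∀ i, Function.Injective (f i)) (hcomp : ∀ i, Computable (f i))
    (C : Set ℕ) (hCinf : C.Infinite) (hCcomp : ComputablePred (· ∈ C)) :
    ∃ H : Set ℕ, H ⊆ C ∧ H.Infinite ∧ ComputablePred (· ∈ H) ∧
      ∀ i, upperDensity (f i '' H) = 0 := by
  obtain ⟨g, hg, hgt, hgid, hgf⟩ := exists_computable_le_tendsto_atTop f hcomp
    fun i => (hinj i).nat_tendsto_atTop
  have hex (x : ℕ) : ∃ c, c ∈ C ∧ x * x < g c := by
    obtain ⟨c, hxc, hc⟩ := ((tendsto_atTop.1 hgt (x * x + 1)).and_frequently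
      (Nat.frequently_atTop_iff_infinite.2 hCinf)).exists
    exact ⟨c, hc, hxc⟩
  have hnext := Computable.find (P := fun x c => c ∈ C ∧ x * x < g c)
    ((hCcomp.comp Computable.snd).and (Computable.natLt
      (Primrec.nat_mul.to_comp.comp Computable.fst Computable.fst) (hg.comp Computable.snd))) hex
  set next : ℕ → ℕ := fun x => Nat.find (hex x)
  have hspec (x : ℕ) : next x ∈ C ∧ x * x < g (next x) := Nat.find_spec (hex x)
  obtain ⟨c₀, hc₀⟩ := hCinf.nonempty
  let h : ℕ → ℕ := fun n => Nat.rec c₀ (fun _ x => next x) n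
  have hh : Computable h := Computable.nat_rec Computable.id (Computable.const c₀)
    (hnext.comp (Computable.snd.comp Computable.snd)).to₂
  have hsucc (n : ℕ) : h (n + 1) = next (h n) := rfl
  have hmono : StrictMono h := strictMono_nat_of_lt_succ fun n =>
    ((Nat.le_mul_self _).trans_lt (hspec (h n)).2).trans_le (hgid _)
  refine ⟨Set.range h, ?_, Set.infinite_range_of_injective hmono.injective,
    hmono.computablePred_range hh, fun i => ?_⟩
  · rintro _ ⟨n, rfl⟩
    cases n with
    | zero => exact hc₀
    | succ n => exact (hspec (h n)).1
  · rw [← Set.range_comp]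
    refine upperDensity_range_eq_zero fun n => ?_
    calc n * n ≤ h n * h n := Nat.mul_le_mul (hmono.id_le n) (hmono.id_le n)
      _ ≤ g (h (n + 1)) := (hspec (h n)).2.le
      _ ≤ f i (h (n + 1)) := hgf i _
end

section
/- Let A, B ⊆ ℕ and r ∈ ℝ. If A has intrinsic density r and B has intrinsic density r, then the join A ⊕ B has intrinsic density r. -/
open Filter Set Topology

open scoped Classical

theorem computable_of_leftInverse_of_rightInverse {f g : ℕ → ℕ} (hf : Computable f)
    (hgf : Function.LeftInverse g f) (hfg : Function.RightInverse g f) : Computable g := by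
  have hd : Computable₂ fun m k : ℕ => decide (f k = m) :=
    (Primrec.eq.decide.to_comp).comp (hf.comp Computable.snd) Computable.fst
  refine (Partrec.rfind hd.partrec₂).of_eq_tot fun m => ?_
  rw [Nat.mem_rfind]
  refine ⟨by simp [hfg m], fun {k} hk => ?_⟩
  have : f k ≠ m := fun h => hk.ne (by rw [← h, hgf k])
  simpa using this

theorem computable_count {χ : ℕ → Bool} (hχ : Computable χ) :
    Computable (Nat.count fun n => χ n = true) := by
  have hstep : Computable₂ fun (_ : ℕ) (q : ℕ × ℕ) => q.2 + bif χ q.1 then 1 else 0 :=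
    Primrec.nat_add.to_comp.comp (Computable.snd.comp Computable.snd)
      (Computable.cond (hχ.comp (Computable.fst.comp Computable.snd))
        (Computable.const 1) (Computable.const 0))
  refine (Computable.nat_rec Computable.id (Computable.const 0) hstep).of_eq fun n => ?_
  induction n with
  | zero => simp
  | succ n ih =>
    simp only [id, Nat.count_succ] at ih ⊢
    rw [ih]
    cases χ n <;> simp

/-- Ranking the values of an injective `f` with infinite computable range gives a permutation. -/
theorem isComputablePerm_count_comp {f : ℕ → ℕ} {χ : ℕ → Bool} (hf : Computable f)
    (hinj : Function.Injective f) (hχ : Computable χ) (hmem : ∀ m, χ m = true ↔ m ∈ range f) :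
    IsComputablePerm fun a => Nat.count (fun m => χ m = true) (f a) := by
  have hval : ∀ a, χ (f a) = true := fun a => (hmem _).2 ⟨a, rfl⟩
  have hinf : {m | χ m = true}.Infinite := by
    rw [show {m | χ m = true} = range f from Set.ext hmem]
    exact infinite_range_of_injective hinj
  refine ⟨⟨fun a b hab => hinj (Nat.count_injective (hval a) (hval b) hab), fun k => ?_⟩,
    (computable_count hχ).comp hf⟩
  obtain ⟨a, ha⟩ := (hmem _).1 (Nat.nth_mem_of_infinite hinf k)
  exact ⟨a, by simp only [ha]; exact Nat.count_nth_of_infinite hinf k⟩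

theorem card_filter_image_eq {f : ℕ → ℕ} {χ : ℕ → Bool}
    (hmem : ∀ m, χ m = true ↔ m ∈ range f) (A : Set ℕ) (n : ℕ) :
    (((Finset.range n).filter (· ∈ f '' A)).card : ℝ) =
      Nat.count (fun m => χ m = true) n *
        pdens ((fun a => Nat.count (fun m => χ m = true) (f a)) '' A)
          (Nat.count (fun m => χ m = true) n) := by
  set c := Nat.count fun m => χ m = true with hc
  have hval : ∀ a, χ (f a) = true := fun a => (hmem _).2 ⟨a, rfl⟩
  have hcard : ((Finset.range n).filter (· ∈ f '' A)).card =
      ((Finset.range (c n)).filter (· ∈ (fun a => c (f a)) '' A)).card := by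
    refine Finset.card_bij (fun m _ => c m) ?_ ?_ ?_
    · intro m hm
      simp only [Finset.mem_filter, Finset.mem_range] at hm ⊢
      obtain ⟨hmn, a, ha, rfl⟩ := hm
      exact ⟨Nat.count_strict_mono (hval a) hmn, a, ha, rfl⟩
    · intro m hm m' hm' h
      simp only [Finset.mem_filter, Finset.mem_range] at hm hm'
      obtain ⟨-, a, -, rfl⟩ := hm
      obtain ⟨-, b, -, rfl⟩ := hm'
      exact Nat.count_injective (hval a) (hval b) h
    · intro k hk
      simp only [Finset.mem_filter, Finset.mem_range] at hk
      obtain ⟨hkn, a, ha, rfl⟩ := hk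
      refine ⟨f a, ?_, rfl⟩
      simp only [Finset.mem_filter, Finset.mem_range]
      exact ⟨Nat.lt_of_count_lt_count hkn, a, ha, rfl⟩
  rw [hcard, pdens]
  rcases Nat.eq_zero_or_pos (c n) with h | h
  · simp [h]
  · field_simp

theorem tendsto_count_atTop {f : ℕ → ℕ} {χ : ℕ → Bool} (hinj : Function.Injective f)
    (hmem : ∀ m, χ m = true ↔ m ∈ range f) :
    Tendsto (Nat.count fun m => χ m = true) atTop atTop := by
  have hinf : {m | χ m = true}.Infinite := by
    rw [show {m | χ m = true} = range f from Set.ext hmem]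
    exact infinite_range_of_injective hinj
  refine tendsto_atTop_atTop_of_monotone (Nat.count_monotone _) fun k => ?_
  exact ⟨_, (Nat.count_nth_of_infinite hinf k).ge⟩

theorem count_add_count_not (χ : ℕ → Bool) (n : ℕ) :
    Nat.count (fun m => χ m = true) n + Nat.count (fun m => (!χ m) = true) n = n := by
  induction n with
  | zero => simp
  | succ n ih =>
    simp only [Nat.count_succ]
    cases χ n <;> simp only [Bool.not_true, Bool.not_false, Bool.false_eq_true, if_true, if_false]
      <;> omega

theorem tendsto_weighted_average {a b : ℕ → ℕ} {u v : ℕ → ℝ} {r : ℝ} (hab : ∀ n, a n + b n = n)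
    (hu : Tendsto u atTop (𝓝 r)) (hv : Tendsto v atTop (𝓝 r)) :
    Tendsto (fun n : ℕ => (a n * u n + b n * v n) / (n : ℝ)) atTop (𝓝 r) := by
  refine Metric.tendsto_atTop.2 fun ε hε => ?_
  obtain ⟨N, hN⟩ := Metric.tendsto_atTop.1 hu ε hε
  obtain ⟨M, hM⟩ := Metric.tendsto_atTop.1 hv ε hε
  refine ⟨max (max N M) 1, fun n hn => ?_⟩
  have hpos : (0 : ℝ) < n := by exact_mod_cast (le_trans (le_max_right _ _) hn : 1 ≤ n)
  have hsum : (a n : ℝ) + b n = n := by exact_mod_cast hab n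
  have hmem := (convex_ball r ε) (hN n (by omega)) (hM n (by omega))
    (show (0 : ℝ) ≤ a n / n by positivity) (show (0 : ℝ) ≤ b n / n by positivity)
    (by rw [← add_div, hsum, div_self hpos.ne'])
  have heq : (a n * u n + b n * v n) / (n : ℝ) = ((a n : ℝ) / n) • u n + ((b n : ℝ) / n) • v n := by
    simp only [smul_eq_mul]
    ring
  rw [heq]
  exact hmem

theorem stmt5 (A B : Set ℕ) (r : ℝ)
    (hA : HasIntrinsicDensity A r) (hB : HasIntrinsicDensity B r) :
    HasIntrinsicDensity (join A B) r := by
  rintro π ⟨hbij, hπ⟩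
  obtain ⟨g, hgπ, hπg⟩ := Function.bijective_iff_has_inverse.1 hbij
  have hg : Computable g := computable_of_leftInverse_of_rightInverse hπ hgπ hπg
  set χ : ℕ → Bool := fun m => decide (g m % 2 = 0) with hχdef
  have hχ : Computable χ :=
    (Primrec.eq.decide.to_comp).comp
      (Primrec.nat_mod.to_comp.comp hg (Computable.const 2)) (Computable.const 0)
  have hχ' : Computable fun m => !χ m := Primrec.not.to_comp.comp hχ
  set e : ℕ → ℕ := fun k => π (2 * k) with hedef
  set o : ℕ → ℕ := fun k => π (2 * k + 1) with hodef
  have hdbl : Computable fun k : ℕ => 2 * k :=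
    (Primrec.nat_mul.comp (Primrec.const 2) Primrec.id).to_comp
  have he : Computable e := hπ.comp hdbl
  have ho : Computable o := hπ.comp (Computable.succ.comp hdbl)
  have heinj : Function.Injective e := fun a b h => by
    have := hbij.1 h
    omega
  have hoinj : Function.Injective o := fun a b h => by
    have := hbij.1 h
    omega
  have hemem : ∀ m, χ m = true ↔ m ∈ range e := fun m => by
    simp only [hχdef, decide_eq_true_eq]
    constructor
    · intro h
      exact ⟨g m / 2, by simp only [hedef]; rw [show 2 * (g m / 2) = g m by omega, hπg]⟩
    · rintro ⟨k, rfl⟩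
      simp [hedef, hgπ (2 * k)]
  have homem : ∀ m, (!χ m) = true ↔ m ∈ range o := fun m => by
    simp only [hχdef, Bool.not_eq_true', decide_eq_false_iff_not]
    constructor
    · intro h
      exact ⟨g m / 2, by simp only [hodef]; rw [show 2 * (g m / 2) + 1 = g m by omega, hπg]⟩
    · rintro ⟨k, rfl⟩
      simp only [hodef, hgπ (2 * k + 1)]
      omega
  have hu := (hA _ (isComputablePerm_count_comp he heinj hχ hemem)).comp
    (tendsto_count_atTop heinj hemem)
  have hv := (hB _ (isComputablePerm_count_comp ho hoinj hχ' homem)).comp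
    (tendsto_count_atTop hoinj homem)
  refine (tendsto_weighted_average (count_add_count_not χ) hu hv).congr fun n => ?_
  have himage : π '' join A B = e '' A ∪ o '' B := by
    simp only [_root_.join, image_union, image_image, hedef, hodef]
  have hdisj : Disjoint (e '' A) (o '' B) := by
    refine Set.disjoint_left.2 ?_
    rintro _ ⟨a, -, rfl⟩ ⟨b, -, h⟩
    have := hbij.1 h
    omega
  simp only [Function.comp_apply]
  rw [← card_filter_image_eq hemem, ← card_filter_image_eq homem, pdens, himage]
  simp only [Set.mem_union, Finset.filter_or]
  rw [Finset.card_union_of_disjoint, Nat.cast_add]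
  exact Finset.disjoint_filter.2 fun m _ h h' => Set.disjoint_left.1 hdisj h h'
end

section
/- Let A, B ⊆ ℕ and r ∈ ℝ. If the join A ⊕ B has intrinsic density r, then A has intrinsic density r and B has intrinsic density r. -/
open Filter Set Topology

open scoped Classical

/-- The increasing enumeration of the complement of `{k ^ 2 + k : k ∈ ℕ}`. -/
def skipPronic (m : ℕ) : ℕ := m + m.sqrt + 1

theorem strictMono_skipPronic : StrictMono skipPronic := fun a b hab => by
  have := Nat.sqrt_le_sqrt hab.le
  unfold skipPronic
  omega

theorem strictMono_pronic : StrictMono fun k : ℕ => k * k + k := fun a b hab => by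
  have := Nat.mul_le_mul hab.le hab.le
  simp only
  omega

theorem pronic_lt_skipPronic_iff {k m : ℕ} : k * k + k < skipPronic m ↔ k ≤ m.sqrt := by
  have h₂ := Nat.lt_succ_sqrt m
  have h₁ := Nat.sqrt_le m
  unfold skipPronic
  constructor
  · intro h
    by_contra! hk
    have := Nat.mul_le_mul (Nat.succ_le_of_lt hk) (Nat.succ_le_of_lt hk)
    grind
  · intro h
    have := Nat.mul_le_mul h h
    omega

theorem skipPronic_ne_pronic (m k : ℕ) : skipPronic m ≠ k * k + k := by
  intro h
  have hk : m.sqrt < k := by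
    by_contra! hk
    have := pronic_lt_skipPronic_iff.2 hk
    omega
  have h₁ := Nat.lt_succ_sqrt m
  have := Nat.mul_le_mul (Nat.succ_le_of_lt hk) (Nat.succ_le_of_lt hk)
  unfold skipPronic at h
  grind

theorem exists_pronic_or_skipPronic (y : ℕ) :
    (∃ k, k * k + k = y) ∨ ∃ m, skipPronic m = y := by
  obtain ⟨k, hk, hk'⟩ : ∃ k, k * k + k ≤ y ∧ y < (k + 1) * (k + 1) + (k + 1) := by
    induction y with
    | zero => exact ⟨0, by simp⟩
    | succ y ih =>
      obtain ⟨k, hk, hk'⟩ := ih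
      by_cases h : y + 1 < (k + 1) * (k + 1) + (k + 1)
      · exact ⟨k, by omega, h⟩
      · exact ⟨k + 1, by omega, by grind⟩
  rcases hk.eq_or_lt with h | h
  · exact .inl ⟨k, h⟩
  · refine .inr ⟨y - k - 1, ?_⟩
    have hs : k = (y - k - 1).sqrt := by
      rw [Nat.eq_sqrt]
      constructor
      · omega
      · grind
    unfold skipPronic
    omega

/-- Sends the even number `2 * n` to the `π n`-th non-pronic number, and the odd numbers to the
pronic ones. -/
def sparsifyOdd (π : ℕ → ℕ) (n : ℕ) : ℕ :=
  cond n.bodd (n.div2 * n.div2 + n.div2) (skipPronic (π n.div2))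

theorem sparsifyOdd_two_mul (π : ℕ → ℕ) (n : ℕ) :
    sparsifyOdd π (2 * n) = skipPronic (π n) := by
  simp [sparsifyOdd, Nat.div2_val]

theorem sparsifyOdd_two_mul_add_one (π : ℕ → ℕ) (n : ℕ) :
    sparsifyOdd π (2 * n + 1) = n * n + n := by
  simp [sparsifyOdd, Nat.div2_val]

theorem IsComputablePerm.sparsifyOdd {π : ℕ → ℕ} (hπ : IsComputablePerm π) :
    IsComputablePerm (sparsifyOdd π) := by
  refine ⟨⟨fun a b hab => ?_, fun y => ?_⟩, ?_⟩
  · rcases a.even_or_odd' with ⟨m, rfl | rfl⟩ <;> rcases b.even_or_odd' with ⟨n, rfl | rfl⟩ <;>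
      simp only [sparsifyOdd_two_mul, sparsifyOdd_two_mul_add_one] at hab
    · rw [hπ.1.1 (strictMono_skipPronic.injective hab)]
    · exact (skipPronic_ne_pronic _ _ hab).elim
    · exact (skipPronic_ne_pronic _ _ hab.symm).elim
    · rw [strictMono_pronic.injective hab]
  · rcases exists_pronic_or_skipPronic y with ⟨k, rfl⟩ | ⟨m, rfl⟩
    · exact ⟨2 * k + 1, sparsifyOdd_two_mul_add_one π k⟩
    · obtain ⟨n, rfl⟩ := hπ.1.2 m
      exact ⟨2 * n, sparsifyOdd_two_mul π n⟩
  · have hskip : Primrec skipPronic :=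
      Primrec.succ.comp (Primrec.nat_add.comp Primrec.id Primrec.nat_sqrt)
    have hpron : Primrec fun n : ℕ => n.div2 * n.div2 + n.div2 :=
      Primrec.nat_add.comp (Primrec.nat_mul.comp Primrec.nat_div2 Primrec.nat_div2)
        Primrec.nat_div2
    exact Computable.cond Computable.nat_bodd hpron.to_comp
      (hskip.to_comp.comp (hπ.2.comp Computable.nat_div2))

/-- The permutation exchanging `2 * n` and `2 * n + 1`. -/
def swapParity (n : ℕ) : ℕ := cond n.bodd (2 * n.div2) (2 * n.div2 + 1)

theorem swapParity_two_mul (n : ℕ) : swapParity (2 * n) = 2 * n + 1 := by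
  simp [swapParity, Nat.div2_val]

theorem swapParity_two_mul_add_one (n : ℕ) : swapParity (2 * n + 1) = 2 * n := by
  simp [swapParity, Nat.div2_val]

theorem swapParity_involutive : Function.Involutive swapParity := fun n => by
  rcases n.even_or_odd' with ⟨m, rfl | rfl⟩ <;>
    simp only [swapParity_two_mul, swapParity_two_mul_add_one]

theorem isComputablePerm_swapParity : IsComputablePerm swapParity := by
  have hdouble : Primrec fun n : ℕ => 2 * n.div2 :=
    Primrec.nat_mul.comp (Primrec.const 2) Primrec.nat_div2
  exact ⟨swapParity_involutive.bijective,
    (Primrec.cond Primrec.nat_bodd hdouble (Primrec.succ.comp hdouble)).to_comp⟩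

theorem swapParity_image_join (A B : Set ℕ) : swapParity '' join A B = join B A := by
  simp only [_root_.join, image_union, image_image, swapParity_two_mul, swapParity_two_mul_add_one]
  exact union_comm _ _

theorem IsComputablePerm.comp {π σ : ℕ → ℕ} (hπ : IsComputablePerm π)
    (hσ : IsComputablePerm σ) : IsComputablePerm (π ∘ σ) :=
  ⟨hπ.1.comp hσ.1, hπ.2.comp hσ.2⟩

theorem HasIntrinsicDensity.join_comm {A B : Set ℕ} {r : ℝ}
    (h : HasIntrinsicDensity (join A B) r) : HasIntrinsicDensity (join B A) r := fun π hπ => by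
  rw [← swapParity_image_join, ← image_comp]
  exact h _ (hπ.comp isComputablePerm_swapParity)

theorem card_le_card_skipPronic_image_union {A B D : Set ℕ}
    (hD : D = skipPronic '' A ∪ (fun k => k * k + k) '' B) (m : ℕ) :
    ((Finset.range m).filter (· ∈ A)).card ≤
      ((Finset.range (skipPronic m)).filter (· ∈ D)).card := by
  rw [← Finset.card_image_of_injective _ strictMono_skipPronic.injective]
  refine Finset.card_le_card fun y hy => ?_
  obtain ⟨a, ha, rfl⟩ := Finset.mem_image.1 hy
  rw [Finset.mem_filter, Finset.mem_range] at ha ⊢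
  exact ⟨strictMono_skipPronic ha.1, hD ▸ .inl ⟨a, ha.2, rfl⟩⟩

theorem card_skipPronic_image_union_le {A B D : Set ℕ}
    (hD : D = skipPronic '' A ∪ (fun k => k * k + k) '' B) (m : ℕ) :
    ((Finset.range (skipPronic m)).filter (· ∈ D)).card ≤
      ((Finset.range m).filter (· ∈ A)).card + (m.sqrt + 1) := by
  have hsub : (Finset.range (skipPronic m)).filter (· ∈ D) ⊆
      ((Finset.range m).filter (· ∈ A)).image skipPronic ∪
        (Finset.range (m.sqrt + 1)).image fun k => k * k + k := by
    intro y hy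
    rw [Finset.mem_filter, Finset.mem_range, hD] at hy
    rw [Finset.mem_union, Finset.mem_image, Finset.mem_image]
    rcases hy with ⟨hy, ⟨a, ha, rfl⟩ | ⟨k, -, rfl⟩⟩
    · exact .inl ⟨a, by simpa using ⟨strictMono_skipPronic.lt_iff_lt.1 hy, ha⟩, rfl⟩
    · exact .inr ⟨k, by simpa [Nat.lt_succ_iff] using pronic_lt_skipPronic_iff.1 hy, rfl⟩
  calc _ ≤ _ := Finset.card_le_card hsub
    _ ≤ _ := Finset.card_union_le _ _
    _ ≤ _ := add_le_add Finset.card_image_le (Finset.card_image_le.trans (by simp))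

theorem tendsto_nat_sqrt_add_one_div :
    Tendsto (fun m : ℕ => ((m.sqrt : ℝ) + 1) / m) atTop (𝓝 0) := by
  have h₁ : Tendsto (fun m : ℕ => (√(m : ℝ))⁻¹ + (m : ℝ)⁻¹) atTop (𝓝 (0 + 0)) :=
    (tendsto_inv_atTop_zero.comp (Real.tendsto_sqrt_atTop.comp tendsto_natCast_atTop_atTop)).add
      (tendsto_inv_atTop_zero.comp tendsto_natCast_atTop_atTop)
  rw [add_zero] at h₁
  refine squeeze_zero (fun m => by positivity) (fun m => ?_) h₁
  rw [← Real.sqrt_div_self, ← one_div (m : ℝ), ← add_div]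
  gcongr
  exact Real.nat_sqrt_le_real_sqrt

/-- Spreading `A` out over the non-pronic numbers, and adding any pronic numbers, does not change
the density. -/
theorem HasDensity.of_skipPronic_image_union {A B : Set ℕ} {r : ℝ}
    (h : HasDensity (skipPronic '' A ∪ (fun k => k * k + k) '' B) r) : HasDensity A r := by
  obtain ⟨D, hDeq⟩ : ∃ D, D = skipPronic '' A ∪ (fun k => k * k + k) '' B := ⟨_, rfl⟩
  rw [← hDeq] at h
  have he := tendsto_nat_sqrt_add_one_div
  have hD : Tendsto (fun m => pdens D (skipPronic m) * (1 + ((m.sqrt : ℝ) + 1) / m)) atTop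
      (𝓝 r) := by
    simpa using (h.comp strictMono_skipPronic.tendsto_atTop).mul (he.const_add 1)
  have hcard : ∀ m : ℕ, 0 < m → pdens D (skipPronic m) * (1 + ((m.sqrt : ℝ) + 1) / m) =
      ((Finset.range (skipPronic m)).filter (· ∈ D)).card / (m : ℝ) := fun m hm => by
    have hs : (skipPronic m : ℝ) = m + (m.sqrt + 1) := by
      simp [skipPronic, add_assoc]
    have hpos : (0 : ℝ) < m + (m.sqrt + 1) := by positivity
    rw [pdens, hs]
    field_simp
  refine tendsto_of_tendsto_of_tendsto_of_le_of_le' (by simpa using hD.sub he) hD ?_ ?_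
  · filter_upwards [eventually_gt_atTop 0] with m hm
    rw [hcard m hm, pdens]
    rw [← sub_div]
    gcongr
    rw [sub_le_iff_le_add]
    exact_mod_cast card_skipPronic_image_union_le hDeq m
  · filter_upwards [eventually_gt_atTop 0] with m hm
    rw [hcard m hm, pdens]
    have := card_le_card_skipPronic_image_union hDeq m
    gcongr ?_ / _
    exact_mod_cast this

theorem HasIntrinsicDensity.of_join {A B : Set ℕ} {r : ℝ}
    (h : HasIntrinsicDensity (join A B) r) : HasIntrinsicDensity A r := fun π hπ => by
  have hσ := h _ hπ.sparsifyOdd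
  simp only [_root_.join, image_union, image_image, sparsifyOdd_two_mul,
    sparsifyOdd_two_mul_add_one] at hσ
  rw [← image_image skipPronic π A] at hσ
  exact hσ.of_skipPronic_image_union

theorem stmt6 (A B : Set ℕ) (r : ℝ) (h : HasIntrinsicDensity (join A B) r) :
    HasIntrinsicDensity A r ∧ HasIntrinsicDensity B r :=
  ⟨h.of_join, h.join_comm.of_join⟩
end

section
/- Let A, B ⊆ ℕ and let π be any computable permutation. Then there exists a computable permutation σ such that the upper density of σ(A ⊕ B) equals the upper density of π(A) and the lower density of σ(A ⊕ B) equals the lower density of π(A). -/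
open Filter Set Topology

open scoped Classical

/-- The `m`-th natural number that is not a perfect square. -/
def nthNonsquare (m : ℕ) : ℕ :=
  m + ((Nat.sqrt (4 * m + 1) + 1) / 2 + 1)

theorem exists_nthNonsquare_eq (m : ℕ) :
    ∃ t, nthNonsquare m = m + (t + 1) ∧ t * t ≤ m + t ∧ m < t * t + t := by
  refine ⟨_, rfl, ?_⟩
  have h₁ := Nat.sqrt_le (4 * m + 1)
  have h₂ := Nat.lt_succ_sqrt (4 * m + 1)
  generalize Nat.sqrt (4 * m + 1) = r at *
  obtain ⟨k, rfl | rfl⟩ := Nat.even_or_odd' r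
  · rw [show (2 * k + 1) / 2 = k by omega]
    constructor <;> nlinarith
  · rw [show (2 * k + 1 + 1) / 2 = k + 1 by omega]
    constructor <;> nlinarith

theorem strictMono_nthNonsquare : StrictMono nthNonsquare := by
  intro a b hab
  have h : Nat.sqrt (4 * a + 1) ≤ Nat.sqrt (4 * b + 1) := Nat.sqrt_le_sqrt (by omega)
  unfold nthNonsquare
  omega

theorem nthNonsquare_ne_mul_self (m k : ℕ) : nthNonsquare m ≠ k * k := by
  obtain ⟨t, ht, h₁, h₂⟩ := exists_nthNonsquare_eq m
  rw [ht]
  intro h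
  rcases le_or_gt k t with hk | hk <;> nlinarith

theorem exists_nthNonsquare_eq_of_ne_sqrt_mul_self {n : ℕ} (hn : n ≠ Nat.sqrt n * Nat.sqrt n) :
    ∃ m, nthNonsquare m = n := by
  have h₁ := Nat.sqrt_le n
  have h₂ := Nat.lt_succ_sqrt n
  generalize Nat.sqrt n = s at *
  have h₃ : s ≤ s * s := Nat.le_mul_self s
  obtain ⟨m, rfl⟩ : ∃ m, n = m + (s + 1) := ⟨n - (s + 1), by
    have : s * s < n := by omega
    omega⟩
  have h₄ : s * s < m + (s + 1) := by omega
  refine ⟨m, ?_⟩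
  obtain ⟨t, ht, ht₁, ht₂⟩ := exists_nthNonsquare_eq m
  have : t = s := by
    rcases lt_trichotomy t s with h | h | h
    · nlinarith
    · exact h
    · nlinarith
  rw [ht, this]

theorem computable_nthNonsquare : Computable nthNonsquare := by
  have h : Primrec nthNonsquare :=
    Primrec.nat_add.comp .id (Primrec.succ.comp (Primrec.nat_div.comp (Primrec.succ.comp
      (Primrec.nat_sqrt.comp (Primrec.succ.comp (Primrec.nat_mul.comp (.const 4) .id))))
      (.const 2)))
  exact h.to_comp

theorem nthNonsquare_le (n : ℕ) : nthNonsquare n ≤ n + (Nat.sqrt n + 3) := by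
  obtain ⟨t, ht, h₁, -⟩ := exists_nthNonsquare_eq n
  have h₂ := Nat.lt_succ_sqrt n
  rw [ht]
  have : t ≤ Nat.sqrt n + 2 := by
    by_contra! h
    obtain ⟨u, rfl⟩ : ∃ u, t = u + 1 := ⟨t - 1, by omega⟩
    nlinarith
  omega

/-- Sends the even numbers to the nonsquares in the order given by `π`, and the odd numbers to the
squares. -/
def spread (π : ℕ → ℕ) (n : ℕ) : ℕ :=
  bif n.bodd then n.div2 * n.div2 else nthNonsquare (π n.div2)

theorem spread_even (π : ℕ → ℕ) (k : ℕ) : spread π (2 * k) = nthNonsquare (π k) := by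
  simp [spread, Nat.div2_val]

theorem spread_odd (π : ℕ → ℕ) (k : ℕ) : spread π (2 * k + 1) = k * k := by
  simp [spread, Nat.div2_val]

theorem isComputablePerm_spread {π : ℕ → ℕ} (hπ : IsComputablePerm π) :
    IsComputablePerm (spread π) := by
  obtain ⟨⟨hi, hs⟩, hc⟩ := hπ
  refine ⟨⟨fun a b hab => ?_, fun n => ?_⟩, ?_⟩
  · obtain ⟨k, rfl | rfl⟩ := Nat.even_or_odd' a <;> obtain ⟨l, rfl | rfl⟩ := Nat.even_or_odd' b <;>
      simp only [spread_even, spread_odd] at hab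
    · rw [hi (strictMono_nthNonsquare.injective hab)]
    · exact absurd hab (nthNonsquare_ne_mul_self _ _)
    · exact absurd hab.symm (nthNonsquare_ne_mul_self _ _)
    · rw [Nat.mul_self_inj.1 hab]
  · by_cases hn : n = Nat.sqrt n * Nat.sqrt n
    · exact ⟨2 * Nat.sqrt n + 1, by rw [spread_odd, ← hn]⟩
    · obtain ⟨m, hm⟩ := exists_nthNonsquare_eq_of_ne_sqrt_mul_self hn
      obtain ⟨k, rfl⟩ := hs m
      exact ⟨2 * k, by rw [spread_even, hm]⟩
  · exact Computable.cond Computable.nat_bodd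
      (Primrec.nat_mul.to_comp.comp Computable.nat_div2 Computable.nat_div2)
      (computable_nthNonsquare.comp (hc.comp Computable.nat_div2))

theorem abs_pdens_sub_pdens_le {D E : Set ℕ} (h₁ : nthNonsquare '' E ⊆ D)
    (h₂ : D ⊆ nthNonsquare '' E ∪ range fun k => k * k) (n : ℕ) :
    |pdens D n - pdens E n| ≤ (√n + 3) / n := by
  have hD : ((Finset.range n).filter (· ∈ D)).card ≤
      ((Finset.range n).filter (· ∈ E)).card + (Nat.sqrt n + 1) := by
    calc _ ≤ (((Finset.range n).filter (· ∈ E)).image nthNonsquare ∪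
          (Finset.range (Nat.sqrt n + 1)).image fun k => k * k).card := by
            refine Finset.card_le_card fun x hx => ?_
            simp only [Finset.mem_filter, Finset.mem_range] at hx
            rw [Finset.mem_union, Finset.mem_image, Finset.mem_image]
            obtain ⟨m, hm, rfl⟩ | ⟨k, rfl⟩ := h₂ hx.2
            · exact .inl ⟨m, by
                simpa [hm] using (strictMono_nthNonsquare.le_apply (x := m)).trans_lt hx.1, rfl⟩
            · exact .inr ⟨k, by
                simpa [Nat.lt_succ_iff] using Nat.le_sqrt.2 hx.1.le, rfl⟩
      _ ≤ _ := (Finset.card_union_le _ _).trans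
          (add_le_add Finset.card_image_le (Finset.card_image_le.trans (Finset.card_range _).le))
  have hE : ((Finset.range n).filter (· ∈ E)).card ≤
      ((Finset.range n).filter (· ∈ D)).card + (Nat.sqrt n + 3) := by
    calc _ = (((Finset.range n).filter (· ∈ E)).image nthNonsquare).card :=
          (Finset.card_image_of_injective _ strictMono_nthNonsquare.injective).symm
      _ ≤ ((Finset.range n).filter (· ∈ D) ∪ Finset.Ico n (n + (Nat.sqrt n + 3))).card := by
          refine Finset.card_le_card fun x hx => ?_
          obtain ⟨m, hm, rfl⟩ := Finset.mem_image.1 hx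
          simp only [Finset.mem_filter, Finset.mem_range] at hm
          have := (strictMono_nthNonsquare hm.1).trans_le (nthNonsquare_le n)
          have hmD := h₁ (mem_image_of_mem _ hm.2)
          simp only [Finset.mem_union, Finset.mem_filter, Finset.mem_range, Finset.mem_Ico]
          rcases lt_or_ge (nthNonsquare m) n with h | h
          · exact .inl ⟨h, hmD⟩
          · exact .inr ⟨h, this⟩
      _ ≤ _ := (Finset.card_union_le _ _).trans (by simp)
  have hs : (Nat.sqrt n : ℝ) ≤ √n := Real.nat_sqrt_le_real_sqrt
  unfold pdens
  rw [← sub_div, abs_div, Nat.abs_cast]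
  gcongr
  have hD' : (_ : ℝ) ≤ _ := Nat.cast_le.2 hD
  have hE' : (_ : ℝ) ≤ _ := Nat.cast_le.2 hE
  push_cast at hD' hE'
  rw [abs_le]
  constructor <;> linarith

theorem tendsto_sqrt_add_three_div :
    Tendsto (fun n : ℕ => (√n + 3) / n) atTop (𝓝 0) := by
  have h : Tendsto (fun n : ℕ => (√(n : ℝ))⁻¹ + 3 / n) atTop (𝓝 (0 + 0)) :=
    ((Real.tendsto_sqrt_atTop.comp tendsto_natCast_atTop_atTop).inv_tendsto_atTop).add
      (tendsto_const_div_atTop_nhds_zero_nat 3)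
  rw [add_zero] at h
  refine h.congr fun n => ?_
  rw [add_div, Real.sqrt_div_self]

theorem pdens_nonneg (A : Set ℕ) (n : ℕ) : 0 ≤ pdens A n := by
  unfold pdens
  positivity

theorem pdens_le_one (A : Set ℕ) (n : ℕ) : pdens A n ≤ 1 := by
  refine div_le_one_of_le₀ ?_ n.cast_nonneg
  exact_mod_cast (Finset.card_filter_le _ _).trans (Finset.card_range n).le

theorem isBoundedUnder_le_pdens (A : Set ℕ) : IsBoundedUnder (· ≤ ·) atTop (pdens A) :=
  isBoundedUnder_of ⟨1, pdens_le_one A⟩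

theorem isBoundedUnder_ge_pdens (A : Set ℕ) : IsBoundedUnder (· ≥ ·) atTop (pdens A) :=
  isBoundedUnder_of ⟨0, pdens_nonneg A⟩

theorem upperDensity_le_of_tendsto_sub {A B : Set ℕ}
    (h : Tendsto (pdens A - pdens B) atTop (𝓝 0)) : upperDensity A ≤ upperDensity B := by
  have := limsup_add_le (isBoundedUnder_ge_pdens B) (isBoundedUnder_le_pdens B)
    h.isBoundedUnder_ge.isCoboundedUnder_le h.isBoundedUnder_le
  rwa [h.limsup_eq, add_zero, add_sub_cancel] at this

theorem le_lowerDensity_of_tendsto_sub {A B : Set ℕ}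
    (h : Tendsto (pdens A - pdens B) atTop (𝓝 0)) : lowerDensity B ≤ lowerDensity A := by
  have := le_liminf_add (isBoundedUnder_ge_pdens B) (isBoundedUnder_le_pdens B)
    h.isBoundedUnder_ge h.isBoundedUnder_le.isCoboundedUnder_ge
  rwa [h.liminf_eq, add_zero, add_sub_cancel] at this

theorem tendsto_pdens_spread_sub (A B : Set ℕ) (π : ℕ → ℕ) :
    Tendsto (pdens (spread π '' join A B) - pdens (π '' A)) atTop (𝓝 0) := by
  refine squeeze_zero_norm (abs_pdens_sub_pdens_le ?_ ?_) tendsto_sqrt_add_three_div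
  · rintro _ ⟨_, ⟨a, ha, rfl⟩, rfl⟩
    exact ⟨2 * a, .inl ⟨a, ha, rfl⟩, spread_even π a⟩
  · rintro _ ⟨_, ⟨a, ha, rfl⟩ | ⟨b, -, rfl⟩, rfl⟩
    · exact .inl ⟨π a, mem_image_of_mem π ha, (spread_even π a).symm⟩
    · exact .inr ⟨b, (spread_odd π b).symm⟩

theorem stmt7 (A B : Set ℕ) (π : ℕ → ℕ) (hπ : IsComputablePerm π) :
    ∃ σ : ℕ → ℕ, IsComputablePerm σ ∧
      upperDensity (σ '' join A B) = upperDensity (π '' A) ∧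
      lowerDensity (σ '' join A B) = lowerDensity (π '' A) := by
  have h := tendsto_pdens_spread_sub A B π
  have h' : Tendsto (pdens (π '' A) - pdens (spread π '' join A B)) atTop (𝓝 0) := by
    simpa [Pi.sub_def] using h.neg
  exact ⟨spread π, isComputablePerm_spread hπ,
    (upperDensity_le_of_tendsto_sub h).antisymm (upperDensity_le_of_tendsto_sub h'),
    (le_lowerDensity_of_tendsto_sub h').antisymm (le_lowerDensity_of_tendsto_sub h)⟩
end

section
/- Let r ∈ ℝ, let π be a computable permutation, let E be the set of even numbers and O the set of odd numbers, and suppose A and B both have intrinsic density r. Then the density of π(A ⊕ B) ◁ π(E) exists and equals r, and the density of π(A ⊕ B) ◁ π(O) exists and equals r. -/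
open Filter Set Topology

open scoped Classical

/-- The inverse of a computable permutation is computable. -/
theorem IsComputablePerm.exists_computable_inverse {π : ℕ → ℕ} (hπ : IsComputablePerm π) :
    ∃ τ : ℕ → ℕ, Computable τ ∧ Function.LeftInverse τ π ∧ Function.RightInverse τ π := by
  obtain ⟨hbij, hcomp⟩ := hπ
  obtain ⟨τ, hl, hr⟩ := Function.bijective_iff_has_inverse.mp hbij
  refine ⟨τ, ?_, hl, hr⟩
  have heq : Computable₂ fun m n : ℕ => decide (π n = m) :=
    Primrec.eq.decide.to_comp.comp (hcomp.comp Computable.snd) Computable.fst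
  refine (Partrec.rfind heq.partrec₂).of_eq_tot fun m => ?_
  refine Nat.mem_rfind.mpr ⟨by simp [hr m], fun {k} hk => ?_⟩
  have hne : π k ≠ m := fun h => hk.ne (by rw [← h, hl])
  simp [hne]

/-- Counting the elements of a decidable set below a bound is computable. -/
theorem computable_count_s8 {p : ℕ → Prop} [DecidablePred p]
    (hp : Computable fun n => decide (p n)) : Computable (Nat.count p) := by
  have hstep : Computable₂ fun (_ : ℕ) (q : ℕ × ℕ) => q.2 + bif decide (p q.1) then 1 else 0 :=
    Primrec.nat_add.to_comp.comp (Computable.snd.comp Computable.snd)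
      (Computable.cond (hp.comp (Computable.fst.comp Computable.snd))
        (Computable.const 1) (Computable.const 0))
  refine (Computable.nat_rec Computable.id (Computable.const 0) hstep).of_eq fun n => ?_
  change Nat.rec 0 (fun y ih => ih + bif decide (p y) then 1 else 0) n = Nat.count p n
  induction n with
  | zero => simp
  | succ n ih => simp only [Nat.count_succ, ih]; by_cases h : p n <;> simp [h]

/-- Sending `n` to the rank of `f n` in the range of `f` is a computable permutation whenever `f`
is computable and injective with computable range. -/
theorem isComputablePerm_count_range {f : ℕ → ℕ} (hf : Computable f)
    (hinj : Function.Injective f) (hrange : Computable fun n => decide (n ∈ range f)) :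
    IsComputablePerm fun n => Nat.count (· ∈ range f) (f n) := by
  refine ⟨⟨fun a b hab => hinj ?_, fun m => ?_⟩, (computable_count_s8 hrange).comp hf⟩
  · exact Nat.count_injective (p := (· ∈ range f)) (mem_range_self a) (mem_range_self b) hab
  · have hinf : (Set.ofPred (· ∈ range f)).Infinite := infinite_range_of_injective hinj
    obtain ⟨n, hn⟩ := Nat.nth_mem_of_infinite hinf m
    exact ⟨n, by simp only [hn]; exact Nat.count_nth_of_infinite hinf m⟩

theorem within_range_eq_image {f : ℕ → ℕ} (hinj : Function.Injective f) (S : Set ℕ) :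
    within S (range f) = (fun n => Nat.count (· ∈ range f) (f n)) '' (f ⁻¹' S) := by
  have hinf : (Set.ofPred (· ∈ range f)).Infinite := infinite_range_of_injective hinj
  ext m
  constructor
  · intro hm
    obtain ⟨n, hn⟩ := Nat.nth_mem_of_infinite hinf m
    refine ⟨n, ?_, by simp only [hn]; exact Nat.count_nth_of_infinite hinf m⟩
    rw [mem_preimage, hn]
    exact hm
  · rintro ⟨n, hn, rfl⟩
    change Nat.nth (· ∈ range f) (Nat.count (· ∈ range f) (f n)) ∈ S
    rw [Nat.nth_count (p := (· ∈ range f)) (mem_range_self n)]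
    exact hn

theorem HasIntrinsicDensity.hasDensity_within_range {f : ℕ → ℕ} {S : Set ℕ} {r : ℝ}
    (hS : HasIntrinsicDensity (f ⁻¹' S) r) (hf : Computable f) (hinj : Function.Injective f)
    (hrange : Computable fun n => decide (n ∈ range f)) :
    HasDensity (within S (range f)) r := by
  rw [within_range_eq_image hinj]
  exact hS _ (isComputablePerm_count_range hf hinj hrange)

/-- The image of a decidable set under a computable permutation is decidable. -/
theorem IsComputablePerm.computable_mem_image {π : ℕ → ℕ} (hπ : IsComputablePerm π) {C : Set ℕ}
    (hC : Computable fun n => decide (n ∈ C)) : Computable fun n => decide (n ∈ π '' C) := by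
  obtain ⟨τ, hτ, hl, hr⟩ := hπ.exists_computable_inverse
  refine (hC.comp hτ).of_eq fun n => ?_
  rw [image_eq_preimage_of_inverse hl hr]
  rfl

theorem IsComputablePerm.hasDensity_within_image_range {π e : ℕ → ℕ} {S : Set ℕ} {r : ℝ}
    (hπ : IsComputablePerm π) (he : Computable e) (hinj : Function.Injective e)
    (hrange : Computable fun n => decide (n ∈ range e)) (hS : HasIntrinsicDensity (e ⁻¹' S) r) :
    HasDensity (within (π '' S) (π '' range e)) r := by
  rw [← range_comp]
  refine HasIntrinsicDensity.hasDensity_within_range ?_ (hπ.2.comp he) (hπ.1.1.comp hinj) ?_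
  · rwa [preimage_comp, preimage_image_eq _ hπ.1.1]
  · rw [range_comp]
    exact hπ.computable_mem_image hrange

theorem computable_decide_even : Computable fun n : ℕ => decide (Even n) :=
  (Primrec.eq.decide.comp (Primrec.nat_mod.comp Primrec.id (Primrec.const 2))
    (Primrec.const 0)).to_comp.of_eq fun n => by simp [Nat.even_iff]

theorem range_two_mul_eq_even : range (fun n : ℕ => 2 * n) = {n | Even n} := by
  ext n
  simp [even_iff_exists_two_mul, eq_comm (a := n)]

theorem range_two_mul_add_one_eq_odd : range (fun n : ℕ => 2 * n + 1) = {n | Odd n} := by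
  ext n
  simp [Odd, eq_comm (a := n)]

theorem preimage_two_mul_join (A B : Set ℕ) : (fun n => 2 * n) ⁻¹' join A B = A := by
  ext n
  have h (x : ℕ) : 2 * x + 1 ≠ 2 * n := by omega
  simp [_root_.join, h]

theorem preimage_two_mul_add_one_join (A B : Set ℕ) :
    (fun n => 2 * n + 1) ⁻¹' join A B = B := by
  ext n
  have h (x : ℕ) : 2 * x ≠ 2 * n + 1 := by omega
  simp [_root_.join, h]

theorem stmt8 (r : ℝ) (π : ℕ → ℕ) (hπ : IsComputablePerm π) (A B : Set ℕ)
    (hA : HasIntrinsicDensity A r) (hB : HasIntrinsicDensity B r) :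
    HasDensity (within (π '' join A B) (π '' {n | Even n})) r ∧
    HasDensity (within (π '' join A B) (π '' {n | Odd n})) r := by
  have hmul : Computable fun n : ℕ => 2 * n :=
    (Primrec.nat_mul.comp (Primrec.const 2) Primrec.id).to_comp
  constructor
  · rw [← range_two_mul_eq_even]
    refine hπ.hasDensity_within_image_range hmul (fun a b h => by simpa using h) ?_ ?_
    · rw [range_two_mul_eq_even]
      exact computable_decide_even.of_eq fun n => by simp
    · rwa [preimage_two_mul_join]
  · rw [← range_two_mul_add_one_eq_odd]
    refine hπ.hasDensity_within_image_range (Computable.succ.comp hmul)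
      (fun a b h => by simpa using h) ?_ ?_
    · rw [range_two_mul_add_one_eq_odd]
      exact (Primrec.not.to_comp.comp computable_decide_even).of_eq fun n => by
        simp [← Nat.not_even_iff_odd]
    · rwa [preimage_two_mul_add_one_join]
end

section
/- Let A, B ⊆ ℕ be infinite. Then the upper density of B ▷ A is at most the product of the upper density of B and the upper density of A: ρ̄(B ▷ A) ≤ ρ̄(B)·ρ̄(A). -/
open Filter Set Topology

open scoped Classical

theorem isBoundedUnder_le_pdens_s10 (A : Set ℕ) {l : Filter ℕ} :
    l.IsBoundedUnder (· ≤ ·) (pdens A) :=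
  isBoundedUnder_of ⟨1, pdens_le_one A⟩

theorem card_filter_into {A : Set ℕ} (hA : A.Infinite) (B : Set ℕ) (n : ℕ) :
    ((Finset.range n).filter (· ∈ into B A)).card =
      ((Finset.range (Nat.count (· ∈ A) n)).filter (· ∈ B)).card := by
  rw [← Finset.card_image_of_injective ((Finset.range _).filter (· ∈ B)) (Nat.nth_injective (p := (· ∈ A)) hA)]
  congr 1
  ext m
  simp only [Finset.mem_filter, Finset.mem_range, Finset.mem_image, into, Set.mem_image, nthElem]
  constructor
  · rintro ⟨hm, b, hb, rfl⟩
    exact ⟨b, ⟨(Nat.lt_nth_iff_count_lt (p := (· ∈ A)) hA).2 hm, hb⟩, rfl⟩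
  · rintro ⟨b, ⟨hb, hbB⟩, rfl⟩
    exact ⟨(Nat.lt_nth_iff_count_lt (p := (· ∈ A)) hA).1 hb, b, hbB, rfl⟩

theorem pdens_into {A : Set ℕ} (hA : A.Infinite) (B : Set ℕ) (n : ℕ) :
    pdens (into B A) n = pdens B (Nat.count (· ∈ A) n) * pdens A n := by
  have hcount := Nat.count_eq_card_filter_range (· ∈ A) n
  unfold pdens
  rw [card_filter_into hA, ← hcount]
  rcases eq_or_ne (Nat.count (· ∈ A) n) 0 with h | h
  · simp [h]
  · have : (Nat.count (· ∈ A) n : ℝ) ≠ 0 := by exact_mod_cast h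
    field_simp

theorem tendsto_count_atTop_s10 {A : Set ℕ} (hA : A.Infinite) :
    Tendsto (Nat.count (· ∈ A)) atTop atTop :=
  tendsto_atTop_atTop_of_monotone (Nat.count_monotone _) fun k =>
    ⟨Nat.nth (· ∈ A) k, (Nat.count_nth_of_infinite (p := (· ∈ A)) hA k).ge⟩

theorem stmt10 (A B : Set ℕ) (hA : A.Infinite) (hB : B.Infinite) :
    upperDensity (into B A) ≤ upperDensity B * upperDensity A := by
  have hcomp : limsup (pdens B ∘ Nat.count (· ∈ A)) atTop ≤ upperDensity B := by
    rw [limsup_comp]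
    exact limsup_le_limsup_of_le (tendsto_count_atTop_s10 hA)
      (isBoundedUnder_of ⟨0, pdens_nonneg B⟩ : IsBoundedUnder (· ≥ ·) _ _).isCoboundedUnder_le
      (isBoundedUnder_le_pdens_s10 B)
  have hA0 : 0 ≤ upperDensity A :=
    le_limsup_of_frequently_le (Frequently.of_forall (pdens_nonneg A)) (isBoundedUnder_le_pdens_s10 A)
  calc upperDensity (into B A)
      = limsup ((pdens B ∘ Nat.count (· ∈ A)) * pdens A) atTop :=
        congrArg (limsup · atTop) (funext (pdens_into hA B))
    _ ≤ limsup (pdens B ∘ Nat.count (· ∈ A)) atTop * limsup (pdens A) atTop :=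
        limsup_mul_le (Frequently.of_forall fun n => pdens_nonneg B _)
          (isBoundedUnder_of ⟨1, fun n => pdens_le_one B _⟩)
          (Eventually.of_forall (pdens_nonneg A)) (isBoundedUnder_le_pdens_s10 A)
    _ ≤ upperDensity B * upperDensity A := mul_le_mul_of_nonneg_right hcomp hA0
end

section
/- Let A, B, C ⊆ ℕ be infinite. Then the 'into' operation is associative: B ▷ (A ▷ C) = (B ▷ A) ▷ C. -/
open Filter Set Topology

open scoped Classical

theorem strictMono_nthElem {A : Set ℕ} (hA : A.Infinite) : StrictMono (nthElem A) :=
  Nat.nth_strictMono hA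

theorem range_nthElem {A : Set ℕ} (hA : A.Infinite) : Set.range (nthElem A) = A :=
  Nat.range_nth_of_infinite hA

theorem infinite_into {A B : Set ℕ} (hA : A.Infinite) (hB : B.Infinite) : (into B A).Infinite :=
  hB.image (strictMono_nthElem hA).injective.injOn

/-- Enumerating `B ▷ A` amounts to enumerating `B` and then `A`. -/
theorem nthElem_into {A B : Set ℕ} (hA : A.Infinite) (hB : B.Infinite) :
    nthElem (into B A) = nthElem A ∘ nthElem B := by
  refine (StrictMono.range_inj (strictMono_nthElem (infinite_into hA hB))
    ((strictMono_nthElem hA).comp (strictMono_nthElem hB))).1 ?_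
  rw [range_nthElem (infinite_into hA hB), Set.range_comp, range_nthElem hB, into]

theorem stmt17 (A B C : Set ℕ) (hA : A.Infinite) (hB : B.Infinite) (hC : C.Infinite) :
    into B (into A C) = into (into B A) C := by
  rw [into, nthElem_into hC hA, Set.image_comp]
  rfl
end
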